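/- Let γ > 0, α ≥ 0, and let T be a proximal-gradient map for (f, g, γ). Given y ∈ ℝⁿ, set y' := T y, x' := y' + α(y' − y), and y'' := T x'. Then F(y'') ≤ F(y) − ((2 − α − γL)/(2γ))·[‖y'' − x'‖² + ‖y' − y‖²]. -/

import Mathlib

open scoped RealInnerProductSpace

section

variable {E : Type*} [NormedAddCommGroup E] [InnerProductSpace ℝ E]

/-- A minimizer of a convex function plus a squared distance satisfies the associated
variational inequality. -/
theorem ConvexOn.prox_variational_inequality {g : E → ℝ} (hg : ConvexOn ℝ Set.univ g)
    {γ : ℝ} (hγ : 0 < γ) {p z : E}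
    (hp : ∀ w, g p + (1 / (2 * γ)) * ‖p - z‖ ^ 2 ≤ g w + (1 / (2 * γ)) * ‖w - z‖ ^ 2) (w : E) :
    g p ≤ g w + (1 / γ) * ⟪p - z, w - p⟫ := by
  have key : ∀ t ∈ Set.Ioc (0 : ℝ) 1,
      0 ≤ (g w - g p + (1 / γ) * ⟪p - z, w - p⟫) + t * ((1 / (2 * γ)) * ‖w - p‖ ^ 2) := by
    intro t ht
    have hconv := hg.2 (Set.mem_univ p) (Set.mem_univ w) (sub_nonneg.2 ht.2) ht.1.le
      (sub_add_cancel 1 t)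
    have hmin := hp ((1 - t) • p + t • w)
    have hdecomp : (1 - t) • p + t • w - z = (p - z) + t • (w - p) := by module
    rw [hdecomp, norm_add_sq_real, norm_smul, inner_smul_right, mul_pow, Real.norm_eq_abs,
      sq_abs] at hmin
    simp only [smul_eq_mul] at hconv
    refine nonneg_of_mul_nonneg_right (a := t) ?_ ht.1
    have hhalf : 1 / γ = 2 * (1 / (2 * γ)) := by field_simp
    rw [hhalf]
    linarith
  have hlim : Filter.Tendsto (fun t : ℝ => (g w - g p + (1 / γ) * ⟪p - z, w - p⟫)
      + t * ((1 / (2 * γ)) * ‖w - p‖ ^ 2)) (nhdsWithin 0 (Set.Ioi 0))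
      (nhds ((g w - g p + (1 / γ) * ⟪p - z, w - p⟫) + 0 * ((1 / (2 * γ)) * ‖w - p‖ ^ 2))) :=
    (Continuous.tendsto (by fun_prop) 0).mono_left nhdsWithin_le_nhds
  have := ge_of_tendsto hlim (Filter.eventually_of_mem (Ioc_mem_nhdsGT one_pos) key)
  linarith

variable [CompleteSpace E]

theorem HasGradientAt.hasDerivAt_comp_add_smul {f : E → ℝ} {x d v : E} {t : ℝ}
    (hf : HasGradientAt f v (x + t • d)) :
    HasDerivAt (fun s : ℝ => f (x + s • d)) ⟪v, d⟫ t := by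
  have hline : HasDerivAt (fun s : ℝ => x + s • d) d t := by
    simpa using ((hasDerivAt_id t).smul_const d).const_add x
  simpa [Function.comp_def] using hf.hasFDerivAt.comp_hasDerivAt t hline

theorem ConvexOn.add_inner_gradient_le {f : E → ℝ} (hf : ConvexOn ℝ Set.univ f) {x v : E}
    (hv : HasGradientAt f v x) (y : E) : f x + ⟪v, y - x⟫ ≤ f y := by
  have hline : ConvexOn ℝ Set.univ (fun s : ℝ => f (x + s • (y - x))) := by
    refine ⟨convex_univ, fun a _ b _ r s hr hs hrs => ?_⟩
    have := hf.2 (Set.mem_univ (x + a • (y - x))) (Set.mem_univ (x + b • (y - x))) hr hs hrs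
    convert this using 2
    obtain rfl : r = 1 - s := by linarith
    simp only [smul_eq_mul]
    module
  have hderiv : HasDerivAt (fun s : ℝ => f (x + s • (y - x))) ⟪v, y - x⟫ 0 :=
    HasGradientAt.hasDerivAt_comp_add_smul (by simpa using hv)
  have := hline.le_slope_of_hasDerivAt (Set.mem_univ 0) (Set.mem_univ 1) one_pos hderiv
  simp [slope_def_field] at this
  linarith

/-- The descent lemma for functions with Lipschitz gradient. -/
theorem le_add_inner_gradient_add_sq {f : E → ℝ} {f' : E → E} {L : ℝ}
    (hf : ∀ x, HasGradientAt f (f' x) x) (hL : ∀ x y, ‖f' x - f' y‖ ≤ L * ‖x - y‖) (x y : E) :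
    f y ≤ f x + ⟪f' x, y - x⟫ + L / 2 * ‖y - x‖ ^ 2 := by
  set d := y - x with hd
  have hderiv : ∀ t : ℝ, HasDerivAt
      (fun s : ℝ => f (x + s • d) - (s * ⟪f' x, d⟫ + L / 2 * ‖d‖ ^ 2 * s ^ 2))
      (⟪f' (x + t • d), d⟫ - (⟪f' x, d⟫ + L / 2 * ‖d‖ ^ 2 * (2 * t))) t := by
    intro t
    refine (hf _).hasDerivAt_comp_add_smul.sub (HasDerivAt.add ?_ ?_)
    · simpa using (hasDerivAt_id t).mul_const ⟪f' x, d⟫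
    · simpa using (hasDerivAt_pow 2 t).const_mul (L / 2 * ‖d‖ ^ 2)
  have hanti : AntitoneOn
      (fun s : ℝ => f (x + s • d) - (s * ⟪f' x, d⟫ + L / 2 * ‖d‖ ^ 2 * s ^ 2)) (Set.Ici 0) := by
    refine antitoneOn_of_deriv_nonpos (convex_Ici 0)
      (fun t _ => (hderiv t).continuousAt.continuousWithinAt)
      (fun t _ => (hderiv t).differentiableAt.differentiableWithinAt) fun t ht => ?_
    rw [interior_Ici] at ht
    rw [(hderiv t).deriv]
    have hinner := real_inner_le_norm (f' (x + t • d) - f' x) d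
    have hlip := hL (x + t • d) x
    rw [add_sub_cancel_left, norm_smul, Real.norm_of_nonneg (le_of_lt ht)] at hlip
    have := mul_le_mul_of_nonneg_right hlip (norm_nonneg d)
    rw [inner_sub_left] at hinner
    linarith
  have := hanti Set.self_mem_Ici (Set.mem_Ici.2 zero_le_one) zero_le_one
  simp [hd] at this
  linarith

end

theorem stmt_5
    (n : ℕ) (hn : 0 < n)
    (L γ α : ℝ) (hL : 0 < L) (hγ : 0 < γ) (hα : 0 ≤ α)
    (f g : EuclideanSpace ℝ (Fin n) → ℝ)
    (f' : EuclideanSpace ℝ (Fin n) → EuclideanSpace ℝ (Fin n))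
    (hf_conv : ConvexOn ℝ Set.univ f)
    (hf_diff : ∀ x, HasGradientAt f (f' x) x)
    (hf_lip : ∀ x y, ‖f' x - f' y‖ ≤ L * ‖x - y‖)
    (hg_conv : ConvexOn ℝ Set.univ g)
    (hmin : ∃ z, ∀ w, f z + g z ≤ f w + g w)
    (T : EuclideanSpace ℝ (Fin n) → EuclideanSpace ℝ (Fin n))
    (hT : ∀ x w, g (T x) + (1 / (2 * γ)) * ‖T x - (x - γ • f' x)‖ ^ 2
        ≤ g w + (1 / (2 * γ)) * ‖w - (x - γ • f' x)‖ ^ 2)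
    (y y' x' y'' : EuclideanSpace ℝ (Fin n))
    (hy' : y' = T y) (hx' : x' = y' + α • (y' - y)) (hy'' : y'' = T x') :
    f y'' + g y'' ≤ (f y + g y)
      - ((2 - α - γ * L) / (2 * γ)) * (‖y'' - x'‖ ^ 2 + ‖y' - y‖ ^ 2) := by
  have hprox : ∀ x w, g (T x) ≤ g w + (1 / γ) * ⟪T x - x, w - T x⟫ + ⟪f' x, w - T x⟫ := by
    intro x w
    have h := hg_conv.prox_variational_inequality hγ (hT x) w
    rw [show T x - (x - γ • f' x) = (T x - x) + γ • f' x by module, inner_add_left,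
      real_inner_smul_left, mul_add, ← mul_assoc, one_div_mul_cancel hγ.ne', one_mul] at h
    linarith
  have hg₁ := hprox y y
  have hg₂ := hprox x' y'
  rw [← hy'] at hg₁
  rw [← hy''] at hg₂
  have hf₁ := le_add_inner_gradient_add_sq hf_diff hf_lip y y'
  have hf₂ := le_add_inner_gradient_add_sq hf_diff hf_lip x' y''
  have hf₃ := hf_conv.add_inner_gradient_le (hf_diff x') y'
  obtain ⟨d, hd⟩ : ∃ d, d = y' - y := ⟨_, rfl⟩
  obtain ⟨e, he⟩ : ∃ e, e = y'' - x' := ⟨_, rfl⟩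
  rw [← hd] at hx'
  rw [show y - y' = -d by rw [hd]; abel, ← hd, inner_neg_right, inner_neg_right,
    real_inner_self_eq_norm_sq] at hg₁
  rw [show y' - y'' = -(α • d + e) by rw [he, hx']; abel, ← he, inner_neg_right,
    inner_neg_right, inner_add_right, inner_add_right, inner_smul_right, inner_smul_right,
    real_inner_self_eq_norm_sq] at hg₂
  rw [show y' - x' = -(α • d) by rw [hx']; abel, inner_neg_right, inner_smul_right] at hf₃
  rw [← hd] at hf₁ ⊢
  rw [← he] at hf₂ ⊢
  have hcross : 0 ≤ α / (2 * γ) * ‖e + d‖ ^ 2 := by positivity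
  rw [norm_add_sq_real] at hcross
  have hcoef : (2 - α - γ * L) / (2 * γ) = 1 / γ - α / (2 * γ) - L / 2 := by field_simp
  have hcoef' : α / (2 * γ) = α * (1 / γ) / 2 := by field_simp
  rw [hcoef, hcoef']
  rw [hcoef'] at hcross
  linarith
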